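/- arXiv:math/0606105 — 8 statements merged into one kernel-verified Lean document; each statement's English description precedes it below -/
import Mathlib

section
/- In any Comm3-algebra A, the square A·A is contained in the center and the associated Lie algebra is two-step nilpotent: for all x,y,z in A one has (x·y)·z = z·(x·y), and the commutator bracket [x,y] = x·y − y·x satisfies [[x,y],z] = 0 for all x,y,z. -/
/-- The commutator bracket of a bilinear multiplication. -/
def br {K : Type*} [Field K] {A : Type*} [AddCommGroup A] [Module K A]
    (μ : A →ₗ[K] A →ₗ[K] A) (x y : A) : A :=
  μ x y - μ y x

/-- In a Comm3-algebra, products lie in the center and the associated Lie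
algebra is two-step nilpotent. -/
theorem comm3_square_central_and_two_step_nilpotent
    {K : Type*} [Field K] {A : Type*} [AddCommGroup A] [Module K A]
    (μ : A →ₗ[K] A →ₗ[K] A)
    (hassoc : ∀ x y z : A, μ (μ x y) z = μ x (μ y z))
    (hswap12 : ∀ x y z : A, μ (μ x y) z = μ (μ y x) z)
    (hswap23 : ∀ x y z : A, μ (μ x y) z = μ (μ x z) y) :
    (∀ x y z : A, μ (μ x y) z = μ z (μ x y)) ∧
    (∀ x y z : A, br μ (br μ x y) z = 0) := by
  have central (x y z : A) : μ (μ x y) z = μ z (μ x y) := by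
    rw [hswap23, hswap12, hassoc]
  refine ⟨central, fun x y z => ?_⟩
  simp only [br, map_sub, LinearMap.sub_apply, ← central, hswap12 y x z, sub_self]
end

section
/- Let A be a tilde-Leibniz algebra, i.e. an associative K-algebra satisfying (x·y)·z = (x·z)·y for all x,y,z. Then any product of two commutators vanishes, [a,b]·[c,d] = 0 for all a,b,c,d (where [x,y] = x·y − y·x), and consequently the derived subalgebra of the associated Lie algebra is abelian: [[a,b],[c,d]] = 0 for all a,b,c,d. -/
/-- Left multiplication kills commutators in a tilde-Leibniz algebra. -/
theorem mul_br_eq_zero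
    {K : Type*} [Field K] {A : Type*} [AddCommGroup A] [Module K A]
    (μ : A →ₗ[K] A →ₗ[K] A)
    (hassoc : ∀ x y z : A, μ (μ x y) z = μ x (μ y z))
    (htilde : ∀ x y z : A, μ (μ x y) z = μ (μ x z) y) (x c d : A) :
    μ x (br μ c d) = 0 := by
  rw [br, map_sub, ← hassoc, ← hassoc, htilde, sub_self]

/-- In a tilde-Leibniz algebra products of commutators vanish, so the derived
Lie subalgebra is abelian. -/
theorem tilde_leibniz_commutator_product_zero
    {K : Type*} [Field K] {A : Type*} [AddCommGroup A] [Module K A]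
    (μ : A →ₗ[K] A →ₗ[K] A)
    (hassoc : ∀ x y z : A, μ (μ x y) z = μ x (μ y z))
    (htilde : ∀ x y z : A, μ (μ x y) z = μ (μ x z) y) :
    (∀ a b c d : A, μ (br μ a b) (br μ c d) = 0) ∧
    (∀ a b c d : A, br μ (br μ a b) (br μ c d) = 0) := by
  have h := mul_br_eq_zero μ hassoc htilde
  refine ⟨fun a b c d => h _ c d, fun a b c d => ?_⟩
  rw [br.eq_def μ (br μ a b), h, h, sub_self]
end

section
/- Let A be a Lie-admissible K-algebra, i.e. As(x,y,z) − As(y,x,z) − As(x,z,y) − As(z,y,x) + As(y,z,x) + As(z,x,y) = 0 for all x,y,z, and let B be a Comm3-algebra. Then the tensor product algebra A⊗B with multiplication (a⊗b)·(a'⊗b') = (a·a')⊗(b·b') is Lie-admissible: for all u,v,w in A⊗B, As(u,v,w) − As(v,u,w) − As(u,w,v) − As(w,v,u) + As(v,w,u) + As(w,u,v) = 0. -/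
open TensorProduct

/-- The associator of a bilinear multiplication. -/
def As {K : Type*} [Field K] {A : Type*} [AddCommGroup A] [Module K A]
    (μ : A →ₗ[K] A →ₗ[K] A) (x y z : A) : A :=
  μ (μ x y) z - μ x (μ y z)

/-- On pure tensors, the associator of a tensor product with an associative algebra factors. -/
theorem As_tmul {K : Type*} [Field K]
    {A : Type*} [AddCommGroup A] [Module K A]
    {B : Type*} [AddCommGroup B] [Module K B]
    (μA : A →ₗ[K] A →ₗ[K] A) (μB : B →ₗ[K] B →ₗ[K] B)
    (hBassoc : ∀ x y z : B, μB (μB x y) z = μB x (μB y z))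
    (μ : TensorProduct K A B →ₗ[K] TensorProduct K A B →ₗ[K] TensorProduct K A B)
    (hμ : ∀ (a a' : A) (b b' : B),
      μ (a ⊗ₜ[K] b) (a' ⊗ₜ[K] b') = (μA a a') ⊗ₜ[K] (μB b b'))
    (x y z : A) (a b c : B) :
    As μ (x ⊗ₜ[K] a) (y ⊗ₜ[K] b) (z ⊗ₜ[K] c) = As μA x y z ⊗ₜ[K] μB (μB a b) c := by
  simp only [As, hμ, TensorProduct.sub_tmul, hBassoc]

section Additivity

variable {K : Type*} [Field K] {A : Type*} [AddCommGroup A] [Module K A]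
  (μ : A →ₗ[K] A →ₗ[K] A) (x x' y y' z z' : A)

theorem As_zero_left : As μ 0 y z = 0 := by simp [As]

theorem As_zero_middle : As μ x 0 z = 0 := by simp [As]

theorem As_zero_right : As μ x y 0 = 0 := by simp [As]

theorem As_add_left : As μ (x + x') y z = As μ x y z + As μ x' y z := by
  simp only [As, map_add, LinearMap.add_apply]; abel

theorem As_add_middle : As μ x (y + y') z = As μ x y z + As μ x y' z := by
  simp only [As, map_add, LinearMap.add_apply]; abel

theorem As_add_right : As μ x y (z + z') = As μ x y z + As μ x y z' := by
  simp only [As, map_add]; abel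

end Additivity

/-- The tensor product of a Lie-admissible algebra with a Comm3-algebra is
Lie-admissible. -/
theorem tensor_lieAdmissible_comm3
    {K : Type*} [Field K]
    {A : Type*} [AddCommGroup A] [Module K A]
    {B : Type*} [AddCommGroup B] [Module K B]
    (μA : A →ₗ[K] A →ₗ[K] A) (μB : B →ₗ[K] B →ₗ[K] B)
    (hA : ∀ x y z : A,
      As μA x y z - As μA y x z - As μA x z y - As μA z y x
        + As μA y z x + As μA z x y = 0)
    (hBassoc : ∀ x y z : B, μB (μB x y) z = μB x (μB y z))
    (hBswap12 : ∀ x y z : B, μB (μB x y) z = μB (μB y x) z)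
    (hBswap23 : ∀ x y z : B, μB (μB x y) z = μB (μB x z) y)
    (μ : TensorProduct K A B →ₗ[K] TensorProduct K A B →ₗ[K] TensorProduct K A B)
    (hμ : ∀ (a a' : A) (b b' : B),
      μ (a ⊗ₜ[K] b) (a' ⊗ₜ[K] b') = (μA a a') ⊗ₜ[K] (μB b b')) :
    ∀ u v w : TensorProduct K A B,
      As μ u v w - As μ v u w - As μ u w v - As μ w v u
        + As μ v w u + As μ w u v = 0 := by
  intro u v w
  induction u with
  | zero => simp only [As_zero_left, As_zero_middle, As_zero_right, sub_zero, add_zero]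
  | add u u' hu hu' =>
    refine Eq.trans ?_ ((congrArg₂ (· + ·) hu hu').trans (add_zero 0))
    simp only [As_add_left, As_add_middle, As_add_right]
    abel
  | tmul x a =>
  induction v with
  | zero => simp only [As_zero_left, As_zero_middle, As_zero_right, sub_zero, add_zero]
  | add v v' hv hv' =>
    refine Eq.trans ?_ ((congrArg₂ (· + ·) hv hv').trans (add_zero 0))
    simp only [As_add_left, As_add_middle, As_add_right]
    abel
  | tmul y b =>
  induction w with
  | zero => simp only [As_zero_left, As_zero_middle, As_zero_right, sub_zero, add_zero]
  | add w w' hw hw' =>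
    refine Eq.trans ?_ ((congrArg₂ (· + ·) hw hw').trans (add_zero 0))
    simp only [As_add_left, As_add_middle, As_add_right]
    abel
  | tmul z c =>
    simp only [As_tmul μA μB hBassoc μ hμ]
    have hbac : μB (μB b a) c = μB (μB a b) c := hBswap12 b a c
    have hacb : μB (μB a c) b = μB (μB a b) c := hBswap23 a c b
    have hbca : μB (μB b c) a = μB (μB a b) c := (hBswap23 b c a).trans hbac
    have hcab : μB (μB c a) b = μB (μB a b) c := (hBswap12 c a b).trans hacb
    have hcba : μB (μB c b) a = μB (μB a b) c := (hBswap12 c b a).trans hbca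
    rw [hbac, hacb, hbca, hcab, hcba]
    simp only [← TensorProduct.sub_tmul, ← TensorProduct.add_tmul, hA,
      TensorProduct.zero_tmul]
end

section
/- Let A be a Vinberg algebra (As(x,y,z) = As(y,x,z) for all x,y,z) and let B be an associative K-algebra satisfying (x·y)·z = (y·x)·z for all x,y,z. Then the tensor product algebra A⊗B with multiplication (a⊗b)·(a'⊗b') = (a·a')⊗(b·b') is a Vinberg algebra: As(u,v,w) = As(v,u,w) for all u,v,w in A⊗B. -/
open TensorProduct

/-- The tensor product of a Vinberg algebra with an associative algebra
satisfying `(x·y)·z = (y·x)·z` is a Vinberg algebra. -/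
theorem tensor_vinberg
    {K : Type*} [Field K]
    {A : Type*} [AddCommGroup A] [Module K A]
    {B : Type*} [AddCommGroup B] [Module K B]
    (μA : A →ₗ[K] A →ₗ[K] A) (μB : B →ₗ[K] B →ₗ[K] B)
    (hA : ∀ x y z : A, As μA x y z = As μA y x z)
    (hBassoc : ∀ x y z : B, μB (μB x y) z = μB x (μB y z))
    (hBswap : ∀ x y z : B, μB (μB x y) z = μB (μB y x) z)
    (μ : TensorProduct K A B →ₗ[K] TensorProduct K A B →ₗ[K] TensorProduct K A B)
    (hμ : ∀ (a a' : A) (b b' : B),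
      μ (a ⊗ₜ[K] b) (a' ⊗ₜ[K] b') = (μA a a') ⊗ₜ[K] (μB b b')) :
    ∀ u v w : TensorProduct K A B, As μ u v w = As μ v u w := by
  intro u v w
  induction u with
  | zero => simp [As]
  | add u₁ u₂ h₁ h₂ =>
    simp only [As, map_add, LinearMap.add_apply] at h₁ h₂ ⊢
    rw [add_sub_add_comm, h₁, h₂, add_sub_add_comm]
  | tmul a b =>
    induction v with
    | zero => simp [As]
    | add v₁ v₂ h₁ h₂ =>
      simp only [As, map_add, LinearMap.add_apply] at h₁ h₂ ⊢
      rw [add_sub_add_comm, h₁, h₂, add_sub_add_comm]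
    | tmul a' b' =>
      induction w with
      | zero => simp [As]
      | add w₁ w₂ h₁ h₂ =>
        simp only [As, map_add] at h₁ h₂ ⊢
        rw [add_sub_add_comm, h₁, h₂, add_sub_add_comm]
      | tmul a'' b'' =>
        have h := hA a a' a''
        simp only [As] at h
        simp only [As, hμ]
        rw [← hBassoc, ← hBassoc, hBswap b' b, ← TensorProduct.sub_tmul,
          ← TensorProduct.sub_tmul, h]
end

section
/- Let A be a G5-associative algebra (As(x,y,z) + As(y,z,x) + As(z,x,y) = 0 for all x,y,z) and let B be an associative K-algebra satisfying (x·y)·z = (y·z)·x for all x,y,z. Then the tensor product algebra A⊗B with multiplication (a⊗b)·(a'⊗b') = (a·a')⊗(b·b') is a G5-associative algebra: As(u,v,w) + As(v,w,u) + As(w,u,v) = 0 for all u,v,w in A⊗B. -/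
open TensorProduct

/-- The tensor product of a G₅-associative algebra with an associative algebra
satisfying `(x·y)·z = (y·z)·x` is a G₅-associative algebra. -/
theorem tensor_g5
    {K : Type*} [Field K]
    {A : Type*} [AddCommGroup A] [Module K A]
    {B : Type*} [AddCommGroup B] [Module K B]
    (μA : A →ₗ[K] A →ₗ[K] A) (μB : B →ₗ[K] B →ₗ[K] B)
    (hA : ∀ x y z : A, As μA x y z + As μA y z x + As μA z x y = 0)
    (hBassoc : ∀ x y z : B, μB (μB x y) z = μB x (μB y z))
    (hBswap : ∀ x y z : B, μB (μB x y) z = μB (μB y z) x)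
    (μ : TensorProduct K A B →ₗ[K] TensorProduct K A B →ₗ[K] TensorProduct K A B)
    (hμ : ∀ (a a' : A) (b b' : B),
      μ (a ⊗ₜ[K] b) (a' ⊗ₜ[K] b') = (μA a a') ⊗ₜ[K] (μB b b')) :
    ∀ u v w : TensorProduct K A B,
      As μ u v w + As μ v w u + As μ w u v = 0 := by
  intro u v w
  induction u using TensorProduct.induction_on with
  | zero => simp [As]
  | add u₁ u₂ h₁ h₂ =>
    simp only [As, map_add, LinearMap.add_apply] at h₁ h₂ ⊢
    rw [← add_zero (0 : TensorProduct K A B)]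
    nth_rewrite 1 [← h₁]
    rw [← h₂]
    abel
  | tmul a x =>
    induction v using TensorProduct.induction_on with
    | zero => simp [As]
    | add v₁ v₂ h₁ h₂ =>
      simp only [As, map_add, LinearMap.add_apply] at h₁ h₂ ⊢
      rw [← add_zero (0 : TensorProduct K A B)]
      nth_rewrite 1 [← h₁]
      rw [← h₂]
      abel
    | tmul b y =>
      induction w using TensorProduct.induction_on with
      | zero => simp [As]
      | add w₁ w₂ h₁ h₂ =>
        simp only [As, map_add, LinearMap.add_apply] at h₁ h₂ ⊢
        rw [← add_zero (0 : TensorProduct K A B)]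
        nth_rewrite 1 [← h₁]
        rw [← h₂]
        abel
      | tmul c z =>
        have h_as (a b c : A) (x y z : B) :
            As μ (a ⊗ₜ[K] x) (b ⊗ₜ[K] y) (c ⊗ₜ[K] z) = As μA a b c ⊗ₜ[K] μB (μB x y) z := by
          simp only [As, hμ, ← hBassoc, TensorProduct.sub_tmul]
        rw [h_as, h_as, h_as, hBswap z x y, ← hBswap x y z, ← TensorProduct.add_tmul,
          ← TensorProduct.add_tmul, hA, TensorProduct.zero_tmul]
end

section
/- Let A be a Leibniz algebra, i.e. a nonassociative K-algebra satisfying x·(y·z) − (x·y)·z + (x·z)·y = 0 for all x,y,z, and let B be an associative K-algebra satisfying (x·y)·z = (x·z)·y for all x,y,z. Then the tensor product algebra A⊗B with multiplication (a⊗b)·(a'⊗b') = (a·a')⊗(b·b') is a Leibniz algebra: u·(v·w) − (u·v)·w + (u·w)·v = 0 for all u,v,w in A⊗B. -/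
open TensorProduct

/-- The tensor product of a Leibniz algebra with an associative algebra
satisfying `(x·y)·z = (x·z)·y` is a Leibniz algebra. -/
theorem tensor_leibniz
    {K : Type*} [Field K]
    {A : Type*} [AddCommGroup A] [Module K A]
    {B : Type*} [AddCommGroup B] [Module K B]
    (μA : A →ₗ[K] A →ₗ[K] A) (μB : B →ₗ[K] B →ₗ[K] B)
    (hA : ∀ x y z : A, μA x (μA y z) - μA (μA x y) z + μA (μA x z) y = 0)
    (hBassoc : ∀ x y z : B, μB (μB x y) z = μB x (μB y z))
    (hBswap : ∀ x y z : B, μB (μB x y) z = μB (μB x z) y)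
    (μ : TensorProduct K A B →ₗ[K] TensorProduct K A B →ₗ[K] TensorProduct K A B)
    (hμ : ∀ (a a' : A) (b b' : B),
      μ (a ⊗ₜ[K] b) (a' ⊗ₜ[K] b') = (μA a a') ⊗ₜ[K] (μB b b')) :
    ∀ u v w : TensorProduct K A B,
      μ u (μ v w) - μ (μ u v) w + μ (μ u w) v = 0 := by
  intro u v w
  induction u with
  | zero => simp
  | add u₁ u₂ h₁ h₂ =>
    simp only [map_add, LinearMap.add_apply]
    linear_combination (norm := abel) h₁ + h₂
  | tmul a b =>
    induction v with
    | zero => simp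
    | add v₁ v₂ h₁ h₂ =>
      simp only [map_add, LinearMap.add_apply]
      linear_combination (norm := abel) h₁ + h₂
    | tmul a' b' =>
      induction w with
      | zero => simp
      | add w₁ w₂ h₁ h₂ =>
        simp only [map_add, LinearMap.add_apply]
        linear_combination (norm := abel) h₁ + h₂
      | tmul a'' b'' =>
        simp only [hμ]
        rw [← hBassoc b b' b'', hBswap b b'' b', ← sub_tmul, ← add_tmul, hA, zero_tmul]
end

section
/- Let A be a nonassociative K-algebra satisfying the Poisson-admissibility identity 3·As(x,y,z) = (x·z)·y + (y·z)·x − (y·x)·z − (z·x)·y for all x,y,z, and let B be a Comm3-algebra. Then the tensor product algebra A⊗B with multiplication (a⊗b)·(a'⊗b') = (a·a')⊗(b·b') satisfies the same identity: 3·As(u,v,w) = (u·w)·v + (v·w)·u − (v·u)·w − (w·u)·v for all u,v,w in A⊗B. -/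
open TensorProduct

/-- The tensor product of a Poisson-admissible algebra with a Comm3-algebra is
Poisson-admissible. -/
theorem tensor_poisson_comm3
    {K : Type*} [Field K] [CharZero K]
    {A : Type*} [AddCommGroup A] [Module K A]
    {B : Type*} [AddCommGroup B] [Module K B]
    (μA : A →ₗ[K] A →ₗ[K] A) (μB : B →ₗ[K] B →ₗ[K] B)
    (hA : ∀ x y z : A,
      (3 : K) • As μA x y z
        = μA (μA x z) y + μA (μA y z) x - μA (μA y x) z - μA (μA z x) y)
    (hBassoc : ∀ x y z : B, μB (μB x y) z = μB x (μB y z))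
    (hBswap12 : ∀ x y z : B, μB (μB x y) z = μB (μB y x) z)
    (hBswap23 : ∀ x y z : B, μB (μB x y) z = μB (μB x z) y)
    (μ : TensorProduct K A B →ₗ[K] TensorProduct K A B →ₗ[K] TensorProduct K A B)
    (hμ : ∀ (a a' : A) (b b' : B),
      μ (a ⊗ₜ[K] b) (a' ⊗ₜ[K] b') = (μA a a') ⊗ₜ[K] (μB b b')) :
    ∀ u v w : TensorProduct K A B,
      (3 : K) • As μ u v w
        = μ (μ u w) v + μ (μ v w) u - μ (μ v u) w - μ (μ w u) v := by
  intro u v w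
  induction u with
  | zero => simp [As]
  | add u u' hu hu' =>
    simp only [As, map_add, LinearMap.add_apply] at hu hu' ⊢
    linear_combination (norm := module) hu + hu'
  | tmul a b =>
    induction v with
    | zero => simp [As]
    | add v v' hv hv' =>
      simp only [As, map_add, LinearMap.add_apply] at hv hv' ⊢
      linear_combination (norm := module) hv + hv'
    | tmul a' b' =>
      induction w with
      | zero => simp [As]
      | add w w' hw hw' =>
        simp only [As, map_add, LinearMap.add_apply] at hw hw' ⊢
        linear_combination (norm := module) hw + hw'
      | tmul a'' b'' =>
        have h₁ : μB (μB b b'') b' = μB (μB b b') b'' := hBswap23 _ _ _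
        have h₂ : μB (μB b' b) b'' = μB (μB b b') b'' := hBswap12 _ _ _
        have h₃ : μB (μB b' b'') b = μB (μB b b') b'' := (hBswap23 _ _ _).trans h₂
        have h₄ : μB (μB b'' b) b' = μB (μB b b') b'' := (hBswap12 _ _ _).trans h₁
        simp only [As, hμ, ← hBassoc, h₁, h₂, h₃, h₄]
        simp only [← TensorProduct.sub_tmul, ← TensorProduct.add_tmul,
          TensorProduct.smul_tmul']
        exact congrArg (· ⊗ₜ[K] μB (μB b b') b'') (hA a a' a'')
end

section
/- Let t be a scalar in K, let A be a nonassociative K-algebra satisfying As(x,y,z) + (1+t)·As(y,x,z) + As(z,y,x) + As(y,z,x) + (1−t)·As(z,x,y) = 0 for all x,y,z, and let B be a Comm3-algebra. Then the tensor product algebra A⊗B with multiplication (a⊗b)·(a'⊗b') = (a·a')⊗(b·b') satisfies the same identity: As(u,v,w) + (1+t)·As(v,u,w) + As(w,v,u) + As(v,w,u) + (1−t)·As(w,u,v) = 0 for all u,v,w in A⊗B. -/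
open TensorProduct

/-- The tensor product of an algebra satisfying the one-parameter
Lie-admissibility identity with a Comm3-algebra satisfies the same identity. -/
theorem tensor_one_parameter_comm3
    {K : Type*} [Field K] [CharZero K] (t : K)
    {A : Type*} [AddCommGroup A] [Module K A]
    {B : Type*} [AddCommGroup B] [Module K B]
    (μA : A →ₗ[K] A →ₗ[K] A) (μB : B →ₗ[K] B →ₗ[K] B)
    (hA : ∀ x y z : A,
      As μA x y z + (1 + t) • As μA y x z + As μA z y x
        + As μA y z x + (1 - t) • As μA z x y = 0)
    (hBassoc : ∀ x y z : B, μB (μB x y) z = μB x (μB y z))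
    (hBswap12 : ∀ x y z : B, μB (μB x y) z = μB (μB y x) z)
    (hBswap23 : ∀ x y z : B, μB (μB x y) z = μB (μB x z) y)
    (μ : TensorProduct K A B →ₗ[K] TensorProduct K A B →ₗ[K] TensorProduct K A B)
    (hμ : ∀ (a a' : A) (b b' : B),
      μ (a ⊗ₜ[K] b) (a' ⊗ₜ[K] b') = (μA a a') ⊗ₜ[K] (μB b b')) :
    ∀ u v w : TensorProduct K A B,
      As μ u v w + (1 + t) • As μ v u w + As μ w v u
        + As μ v w u + (1 - t) • As μ w u v = 0 := by
  have as_tmul (x y z : A) (a b c : B) :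
      As μ (x ⊗ₜ[K] a) (y ⊗ₜ[K] b) (z ⊗ₜ[K] c)
        = As μA x y z ⊗ₜ[K] μB (μB a b) c := by
    simp only [As, hμ, TensorProduct.sub_tmul, hBassoc]
  intro u v w
  induction u using TensorProduct.induction_on with
  | zero => simp [As]
  | add u₁ u₂ h₁ h₂ =>
    have h := congrArg₂ (· + ·) h₁ h₂
    simp only [add_zero] at h
    rw [← h]
    simp only [As, map_add, LinearMap.add_apply]
    module
  | tmul x a =>
    induction v using TensorProduct.induction_on with
    | zero => simp [As]
    | add v₁ v₂ h₁ h₂ =>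
      have h := congrArg₂ (· + ·) h₁ h₂
      simp only [add_zero] at h
      rw [← h]
      simp only [As, map_add, LinearMap.add_apply]
      module
    | tmul y b =>
      induction w using TensorProduct.induction_on with
      | zero => simp [As]
      | add w₁ w₂ h₁ h₂ =>
        have h := congrArg₂ (· + ·) h₁ h₂
        simp only [add_zero] at h
        rw [← h]
        simp only [As, map_add, LinearMap.add_apply]
        module
      | tmul z c =>
        have hbac : μB (μB b a) c = μB (μB a b) c := hBswap12 b a c
        have hbca : μB (μB b c) a = μB (μB a b) c := (hBswap23 b c a).trans hbac
        have hcba : μB (μB c b) a = μB (μB a b) c := (hBswap12 c b a).trans hbca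
        have hcab : μB (μB c a) b = μB (μB a b) c := (hBswap23 c a b).trans hcba
        simp only [as_tmul, hbac, hbca, hcba, hcab, TensorProduct.smul_tmul',
          ← TensorProduct.add_tmul, hA, TensorProduct.zero_tmul]
end
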